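/- Let m, d be integers with m ≥ d ≥ 2, N = m^d, and let θ ∈ [0, π/2]. Then the difference of expected squared L₂-discrepancies is exactly 𝔼L₂²(P_{Ω*∼(θ)}) − 𝔼L₂²(P_{Ω*_|}) = (1/N³)·(1/3^{d−2})·P(θ). -/

import Mathlib

open MeasureTheory Real Set

noncomputable section

/-- The unit cube `[0,1]^d`. -/
def unitCube (d : ℕ) : Set (Fin d → ℝ) := Set.univ.pi fun _ => Set.Icc (0 : ℝ) 1

/-- The anchored half-open box `[0, z) = ∏ⱼ [0, zⱼ)`. -/
def lowerBox {d : ℕ} (z : Fin d → ℝ) : Set (Fin d → ℝ) := {y | ∀ i, 0 ≤ y i ∧ y i < z i}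

/-- The squared `L₂`-discrepancy of a point configuration `P` in `[0,1]^d`:
`∫_{[0,1]^d} (λ([0,z)) - (1/N) #{i : P i ∈ [0,z)})² dz`. -/
def L2sq {d : ℕ} {ι : Type} [Fintype ι] (P : ι → Fin d → ℝ) : ℝ :=
  ∫ z in unitCube d,
    ((volume (lowerBox z)).toReal
      - (Fintype.card ι : ℝ)⁻¹ * (Nat.card {i // P i ∈ lowerBox z} : ℝ)) ^ 2

/-- The joint distribution of the stratified sample associated to a partition `Ω`:
independent points, the `i`-th uniformly distributed on `Ω i`. -/
def stratified {d : ℕ} {ι : Type} [Fintype ι] (Ω : ι → Set (Fin d → ℝ)) :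
    Measure (ι → Fin d → ℝ) :=
  Measure.pi fun i => ProbabilityTheory.cond volume (Ω i)

/-- Expected squared `L₂`-discrepancy of the stratified sample from the partition `Ω`. -/
def expL2sq {d : ℕ} {ι : Type} [Fintype ι] (Ω : ι → Set (Fin d → ℝ)) : ℝ :=
  ∫ P, L2sq P ∂(stratified Ω)

/-- The rectangle `I = [0,2] × [0,1] ⊆ ℝ²`. -/
def I2 : Set (ℝ × ℝ) := Set.Icc (0 : ℝ) 2 ×ˢ Set.Icc (0 : ℝ) 1

open scoped Classical in
/-- The cell `Ω₁(θ)` of the one-parameter family of partitions of `[0,2] × [0,1]`. -/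
def Omega1 (θ : ℝ) : Set (ℝ × ℝ) :=
  if θ = π / 2 then Set.Icc (0 : ℝ) 1 ×ˢ Set.Icc (0 : ℝ) 1
  else if θ < arctan (1 / 2) then {p ∈ I2 | p.2 ≤ (1 - p.1) * tan θ + 1 / 2}
  else {p ∈ I2 | (p.1 - 1) * tan θ + p.2 ≤ 1 / 2}

/-- The cell `Ω₂(θ)`: the closure of the complement of `Ω₁(θ)` in `[0,2] × [0,1]`. -/
def Omega2 (θ : ℝ) : Set (ℝ × ℝ) := closure (I2 \ Omega1 θ)

/-- The anchor point `a = ((m-2)/m, (m-1)/m, …, (m-1)/m)`. -/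
def anchor (m d : ℕ) : Fin d → ℝ := fun j => if (j : ℕ) = 0 then ((m : ℝ) - 2) / m else ((m : ℝ) - 1) / m

/-- The two corner cells `a + (1/m)·(Ωᵢ(θ) × [0,1]^{d-2})`, `i = 1, 2`. -/
def cornerCell (m d : ℕ) (hd : 2 ≤ d) (θ : ℝ) (i : Fin 2) : Set (Fin d → ℝ) :=
  (fun x : Fin d → ℝ => fun j => anchor m d j + x j / m) ''
    {x : Fin d → ℝ |
      (x ⟨0, by omega⟩, x ⟨1, by omega⟩) ∈ (if i = 0 then Omega1 θ else Omega2 θ) ∧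
      ∀ j : Fin d, 2 ≤ (j : ℕ) → x j ∈ Set.Icc (0 : ℝ) 1}

/-- The axis-parallel grid cell of side `1/m` indexed by `k`. -/
def gridCell {d : ℕ} (m : ℕ) (k : Fin d → Fin m) : Set (Fin d → ℝ) :=
  Set.univ.pi fun j => Set.Ico ((k j : ℝ) / m) (((k j : ℝ) + 1) / m)

open scoped Classical in
/-- The partition `Ω*∼(θ)` of `[0,1]^d`: all grid cells of side `1/m` except the two
top-corner ones, which are replaced by the two cells `a + (1/m)·(Ωᵢ(θ) × [0,1]^{d-2})`. -/
def OmegaStarSim (m d : ℕ) (hd : 2 ≤ d) (θ : ℝ) : (Fin d → Fin m) → Set (Fin d → ℝ) :=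
  fun k =>
    if ∀ j : Fin d, (k j : ℕ) = (if (j : ℕ) = 0 then m - 2 else m - 1) then
      cornerCell m d hd θ 0
    else if ∀ j : Fin d, (k j : ℕ) = m - 1 then cornerCell m d hd θ 1
    else gridCell m k

end

open scoped Classical in
/-- The piecewise function `P(θ)` appearing in the expected `L₂`-discrepancy bounds. -/
noncomputable def Pfun (θ : ℝ) : ℝ :=
  if θ < Real.arctan (1 / 2) then
    (2 / 45) * Real.tan θ ^ 3 + (2 / 15) * Real.tan θ ^ 2 - (1 / 6) * Real.tan θ
  else if θ = Real.arctan (1 / 2) then -(2 / 45)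
  else
    -(1 / 24) * Real.cot θ + (1 / 120) * Real.cot θ ^ 2 + (1 / 1440) * Real.cot θ ^ 3

/-- The area of the part of `[0, u] × [0, v]` lying above the line of slope `-s` through
`(1/2, 1/2)`. -/
noncomputable def aboveArea (s u v : ℝ) : ℝ :=
  ∫ x in (0 : ℝ)..u, max (v - (1 / 2 + (1 / 2 - x) * s)) 0

lemma integral_zero_max_zero (b : ℝ) : ∫ x in (0 : ℝ)..b, max x 0 = (max b 0) ^ 2 / 2 := by
  rcases le_total 0 b with hb | hb
  · have : ∫ x in (0 : ℝ)..b, max x 0 = ∫ x in (0 : ℝ)..b, x := by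
      refine intervalIntegral.integral_congr fun x hx => ?_
      rw [uIcc_of_le hb] at hx
      exact max_eq_left hx.1
    rw [this, integral_id, max_eq_left hb]
    ring
  · have : ∫ x in (0 : ℝ)..b, max x 0 = ∫ x in (0 : ℝ)..b, (0 : ℝ) := by
      refine intervalIntegral.integral_congr fun x hx => ?_
      rw [uIcc_of_ge hb] at hx
      exact max_eq_right hx.2
    rw [this, intervalIntegral.integral_zero, max_eq_right hb]
    ring

lemma integral_max_zero (a b : ℝ) :
    ∫ x in a..b, max x 0 = (max b 0) ^ 2 / 2 - (max a 0) ^ 2 / 2 := by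
  have hinterval : ∀ a b : ℝ, IntervalIntegrable (fun x : ℝ => max x 0) volume a b := fun a b =>
    Continuous.intervalIntegrable (by fun_prop) a b
  rw [← integral_zero_max_zero, ← integral_zero_max_zero,
    intervalIntegral.integral_interval_sub_left (hinterval _ _) (hinterval _ _)]

lemma aboveArea_of_ne_zero {s : ℝ} (hs : s ≠ 0) (u v : ℝ) :
    aboveArea s u v = (max (v - (1 / 2 + s / 2 - s * u)) 0 ^ 2
      - max (v - (1 / 2 + s / 2)) 0 ^ 2) / (2 * s) := by
  have h := intervalIntegral.integral_comp_add_mul (a := 0) (b := u) (fun y : ℝ => max y 0) hs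
    (v - (1 / 2 + s / 2))
  rw [integral_max_zero] at h
  have e : ∀ x : ℝ, v - (1 / 2 + (1 / 2 - x) * s) = v - (1 / 2 + s / 2) + s * x := fun x => by ring
  simp only [aboveArea, e]
  rw [h, mul_zero, add_zero, smul_eq_mul,
    show v - (1 / 2 + s / 2) + s * u = v - (1 / 2 + s / 2 - s * u) by ring]
  field_simp

lemma aboveArea_zero (u v : ℝ) : aboveArea 0 u v = u * max (v - 1 / 2) 0 := by
  simp [aboveArea]

lemma continuous_aboveArea (s : ℝ) : Continuous fun p : ℝ × ℝ => aboveArea s p.1 p.2 := by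
  by_cases hs : s = 0
  · subst hs
    simp only [aboveArea_zero]
    fun_prop
  · simp only [aboveArea_of_ne_zero hs]
    fun_prop

lemma integral_quintic (c₀ c₁ c₂ c₃ c₄ c₅ a b : ℝ) :
    ∫ x in a..b, (c₀ + c₁ * x + c₂ * x ^ 2 + c₃ * x ^ 3 + c₄ * x ^ 4 + c₅ * x ^ 5)
      = (c₀ * b + c₁ * b ^ 2 / 2 + c₂ * b ^ 3 / 3 + c₃ * b ^ 4 / 4 + c₄ * b ^ 5 / 5
          + c₅ * b ^ 6 / 6)
        - (c₀ * a + c₁ * a ^ 2 / 2 + c₂ * a ^ 3 / 3 + c₃ * a ^ 4 / 4 + c₄ * a ^ 5 / 5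
          + c₅ * a ^ 6 / 6) := by
  refine intervalIntegral.integral_eq_sub_of_hasDerivAt
    (f := fun x => c₀ * x + c₁ * x ^ 2 / 2 + c₂ * x ^ 3 / 3 + c₃ * x ^ 4 / 4 + c₄ * x ^ 5 / 5
      + c₅ * x ^ 6 / 6)
    (fun x _ => ?_) (Continuous.intervalIntegrable (by fun_prop) _ _)
  have h := (((((((hasDerivAt_id x).const_mul c₀).add
    (((hasDerivAt_pow 2 x).const_mul c₁).div_const 2)).add
    (((hasDerivAt_pow 3 x).const_mul c₂).div_const 3)).add
    (((hasDerivAt_pow 4 x).const_mul c₃).div_const 4)).add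
    (((hasDerivAt_pow 5 x).const_mul c₄).div_const 5)).add
    (((hasDerivAt_pow 6 x).const_mul c₅).div_const 6))
  refine h.congr_deriv ?_
  norm_num
  ring

/-- Antiderivative in `v` of `(u v - k)² + k²` with `k = k₀ + k₁ v + k₂ v²`. -/
lemma integral_split_of_quadratic (u k₀ k₁ k₂ a b : ℝ) {K : ℝ → ℝ} (hab : a ≤ b)
    (hK : ∀ v ∈ Set.Icc a b, K v = k₀ + k₁ * v + k₂ * v ^ 2) :
    ∫ v in a..b, ((u * v - K v) ^ 2 + K v ^ 2)
      = (2 * k₀ ^ 2 * (b - a) + (4 * k₀ * k₁ - 2 * u * k₀) * (b ^ 2 - a ^ 2) / 2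
        + (u ^ 2 - 2 * u * k₁ + 2 * k₁ ^ 2 + 4 * k₀ * k₂) * (b ^ 3 - a ^ 3) / 3
        + (4 * k₁ * k₂ - 2 * u * k₂) * (b ^ 4 - a ^ 4) / 4
        + 2 * k₂ ^ 2 * (b ^ 5 - a ^ 5) / 5) := by
  rw [intervalIntegral.integral_congr (g := fun v => (2 * k₀ ^ 2
    + (4 * k₀ * k₁ - 2 * u * k₀) * v + (u ^ 2 - 2 * u * k₁ + 2 * k₁ ^ 2 + 4 * k₀ * k₂) * v ^ 2
    + (4 * k₁ * k₂ - 2 * u * k₂) * v ^ 3 + 2 * k₂ ^ 2 * v ^ 4 + 0 * v ^ 5))]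
  · rw [integral_quintic]
    ring
  · intro v hv
    rw [uIcc_of_le hab] at hv
    simp only [hK v hv]
    ring

lemma integral_aboveArea_slice {s u : ℝ} (hs : 0 ≤ s) (hs1 : s ≤ 1) (hu : u ∈ Set.Icc (0 : ℝ) 1) :
    ∫ v in (0 : ℝ)..1, ((u * v - aboveArea s u v) ^ 2 + aboveArea s u v ^ 2)
      = (1 / 3 - 2 * ((1 - ((1 + s) / 2) ^ 3) / 3 - ((1 + s) / 2) * (1 - ((1 + s) / 2) ^ 2) / 2)
          + 2 * ((1 - s) / 2) ^ 3 / 3) * u ^ 2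
        + s * (((1 - s) / 2) ^ 2 - (1 - ((1 + s) / 2) ^ 2) / 2) * u ^ 3
        + s ^ 2 * ((1 - s) / 4 - (1 + s) / 6) * u ^ 4 + 11 / 60 * s ^ 3 * u ^ 5 := by
  have hinterval : ∀ a b : ℝ, IntervalIntegrable
      (fun v => (u * v - aboveArea s u v) ^ 2 + aboveArea s u v ^ 2) volume a b := fun a b => by
    have : Continuous fun v => aboveArea s u v :=
      (continuous_aboveArea s).comp (Continuous.prodMk_right u)
    exact Continuous.intervalIntegrable (by fun_prop) a b
  rcases hs.eq_or_lt with rfl | hpos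
  · rw [← intervalIntegral.integral_add_adjacent_intervals (hinterval 0 (1 / 2)) (hinterval (1 / 2) 1),
      integral_split_of_quadratic u 0 0 0 0 (1 / 2) (by norm_num),
      integral_split_of_quadratic u (-u / 2) u 0 (1 / 2) 1 (by norm_num)]
    · ring
    · intro v hv
      rw [aboveArea_zero, max_eq_left (by linarith [hv.1])]
      ring
    · intro v hv
      rw [aboveArea_zero, max_eq_right (by linarith [hv.2])]
      ring
  · have hsu : 0 ≤ s * u := mul_nonneg hs hu.1
    have hsu1 : s * u ≤ s := mul_le_of_le_one_right hs hu.2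
    set p := 1 / 2 + s / 2 - s * u with hp
    rw [← intervalIntegral.integral_add_adjacent_intervals (hinterval 0 p) (hinterval p 1),
      ← intervalIntegral.integral_add_adjacent_intervals (hinterval p (1 / 2 + s / 2))
        (hinterval (1 / 2 + s / 2) 1),
      integral_split_of_quadratic u 0 0 0 0 p (by linarith),
      integral_split_of_quadratic u (p ^ 2 / (2 * s)) (-p / s) (1 / (2 * s)) p _ (by linarith),
      integral_split_of_quadratic u (-u * (1 + s - s * u) / 2) u 0 _ 1 (by linarith)]
    · rw [hp]
      field_simp
      ring
    · intro v hv
      rw [aboveArea_of_ne_zero hpos.ne', max_eq_left (by linarith [hv.1]),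
        max_eq_left (by linarith [hv.1])]
      field_simp
      ring
    · intro v hv
      rw [aboveArea_of_ne_zero hpos.ne', max_eq_left (by linarith [hv.1]),
        max_eq_right (by linarith [hv.2])]
      field_simp
      ring
    · intro v hv
      rw [aboveArea_of_ne_zero hpos.ne', max_eq_right (by linarith [hv.2]),
        max_eq_right (by linarith [hv.2])]
      simp

lemma integral_aboveArea {s : ℝ} (hs : 0 ≤ s) (hs1 : s ≤ 1) :
    ∫ u in (0 : ℝ)..1, ∫ v in (0 : ℝ)..1, ((u * v - aboveArea s u v) ^ 2 + aboveArea s u v ^ 2)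
      = (5 / 9 + s / 12 - s ^ 2 / 30 - s ^ 3 / 180) / 8 := by
  rw [intervalIntegral.integral_congr (g := fun u => 0 + 0 * u
    + (1 / 3 - 2 * ((1 - ((1 + s) / 2) ^ 3) / 3 - ((1 + s) / 2) * (1 - ((1 + s) / 2) ^ 2) / 2)
          + 2 * ((1 - s) / 2) ^ 3 / 3) * u ^ 2
        + s * (((1 - s) / 2) ^ 2 - (1 - ((1 + s) / 2) ^ 2) / 2) * u ^ 3
        + s ^ 2 * ((1 - s) / 4 - (1 + s) / 6) * u ^ 4 + 11 / 60 * s ^ 3 * u ^ 5)]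
  · rw [integral_quintic]
    ring
  · intro u hu
    rw [uIcc_of_le zero_le_one] at hu
    simp only [integral_aboveArea_slice hs hs1 hu]
    ring

lemma aboveArea_one_one {s : ℝ} (hs : 0 ≤ s) (hs1 : s ≤ 1) : aboveArea s 1 1 = 1 / 2 := by
  rcases hs.eq_or_lt with rfl | hpos
  · rw [aboveArea_zero]
    norm_num
  · rw [aboveArea_of_ne_zero hpos.ne', max_eq_left (by linarith), max_eq_left (by linarith)]
    field_simp
    ring

lemma real_volume_regionBetween_const {h : ℝ → ℝ} (hh : Continuous h) {u : ℝ} (hu : 0 ≤ u) (v : ℝ) :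
    volume.real (regionBetween h (fun _ => v) (Set.Ico 0 u))
      = ∫ x in (0 : ℝ)..u, max (v - h x) 0 := by
  have hvol : volume (regionBetween h (fun _ => v) (Set.Ico 0 u))
      = ∫⁻ x in Set.Ico 0 u, ENNReal.ofReal (max (v - h x) 0) := by
    rw [Measure.volume_eq_prod, volume_regionBetween_eq_lintegral hh.measurable.aemeasurable
      measurable_const.aemeasurable measurableSet_Ico]
    simp [ENNReal.ofReal_max]
  rw [measureReal_def, hvol, intervalIntegral.integral_of_le hu, ← integral_Ico_eq_integral_Ioc,
    integral_eq_lintegral_of_nonneg_ae (f := fun x => max (v - h x) 0)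
      (Filter.Eventually.of_forall fun x => le_max_right _ _)
      (Continuous.aestronglyMeasurable (by fun_prop))]

lemma real_volume_above {t : ℝ} (ht : 0 ≤ t) (ht2 : t ≤ 1 / 2) {p : ℝ × ℝ} (hp : p ∈ I2) :
    volume.real ({q ∈ I2 | 1 / 2 + (1 - q.1) * t < q.2} ∩ Set.Iio p.1 ×ˢ Set.Iio p.2)
      = 2 * aboveArea (2 * t) (p.1 / 2) p.2 := by
  obtain ⟨⟨hp1, hp2⟩, hp3, hp4⟩ := hp
  have hset : {q ∈ I2 | 1 / 2 + (1 - q.1) * t < q.2} ∩ Set.Iio p.1 ×ˢ Set.Iio p.2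
      = regionBetween (fun x => 1 / 2 + (1 - x) * t) (fun _ => p.2) (Set.Ico 0 p.1) := by
    ext ⟨x, y⟩
    simp only [I2, regionBetween, Set.mem_inter_iff, Set.mem_ofPred_eq, Set.mem_prod, Set.mem_Icc,
      Set.mem_Iio, Set.mem_Ico, Set.mem_Ioo]
    constructor
    · rintro ⟨⟨⟨⟨h1, h2⟩, h3, h4⟩, h5⟩, h6, h7⟩
      exact ⟨⟨h1, h6⟩, h5, h7⟩
    · rintro ⟨⟨h1, h2⟩, h3, h4⟩
      have : 0 ≤ (2 - x) * t := mul_nonneg (by linarith) ht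
      exact ⟨⟨⟨⟨h1, by linarith⟩, by nlinarith, by linarith⟩, h3⟩, h2, h4⟩
  rw [hset, real_volume_regionBetween_const (by fun_prop) hp1, aboveArea]
  have h := intervalIntegral.integral_comp_mul_left (a := 0) (b := p.1 / 2)
    (fun x => max (p.2 - (1 / 2 + (1 - x) * t)) 0) (two_ne_zero (α := ℝ))
  rw [mul_zero, mul_div_cancel₀ _ two_ne_zero, smul_eq_mul] at h
  rw [← mul_right_inj' (two_ne_zero (α := ℝ)), mul_inv_cancel_left₀ two_ne_zero] at h
  rw [← h]
  congr 1
  refine intervalIntegral.integral_congr fun x _ => ?_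
  congr 1
  ring

lemma real_volume_right {c : ℝ} (hc : 0 ≤ c) (hc2 : c ≤ 2) {p : ℝ × ℝ} (hp : p ∈ I2) :
    volume.real ({q ∈ I2 | 1 + (1 / 2 - q.2) * c < q.1} ∩ Set.Iio p.1 ×ˢ Set.Iio p.2)
      = 2 * aboveArea (c / 2) p.2 (p.1 / 2) := by
  obtain ⟨⟨hp1, hp2⟩, hp3, hp4⟩ := hp
  have hset : {q ∈ I2 | 1 + (1 / 2 - q.2) * c < q.1} ∩ Set.Iio p.1 ×ˢ Set.Iio p.2
      = Prod.swap ⁻¹' regionBetween (fun y => 1 + (1 / 2 - y) * c) (fun _ => p.1)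
        (Set.Ico 0 p.2) := by
    ext ⟨x, y⟩
    simp only [I2, regionBetween, Set.mem_inter_iff, Set.mem_ofPred_eq, Set.mem_prod, Set.mem_Icc,
      Set.mem_Iio, Set.mem_Ico, Set.mem_Ioo, Set.mem_preimage, Prod.swap]
    constructor
    · rintro ⟨⟨⟨⟨h1, h2⟩, h3, h4⟩, h5⟩, h6, h7⟩
      exact ⟨⟨h3, h7⟩, h5, h6⟩
    · rintro ⟨⟨h1, h2⟩, h3, h4⟩
      have : 0 ≤ (1 - y) * c := mul_nonneg (by linarith) hc
      exact ⟨⟨⟨⟨by nlinarith, by linarith⟩, h1, by linarith⟩, h3⟩, h4, h2⟩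
  have hmeas : MeasurableSet (regionBetween (fun y => 1 + (1 / 2 - y) * c) (fun _ => p.1)
      (Set.Ico 0 p.2)) :=
    measurableSet_regionBetween (by fun_prop) (by fun_prop) measurableSet_Ico
  have hswap : MeasurePreserving (Prod.swap : ℝ × ℝ → ℝ × ℝ) volume volume :=
    Measure.measurePreserving_swap
  rw [hset, hswap.measureReal_preimage hmeas.nullMeasurableSet,
    real_volume_regionBetween_const (by fun_prop) hp3, aboveArea,
    ← intervalIntegral.integral_const_mul]
  refine intervalIntegral.integral_congr fun x _ => ?_
  rw [mul_max_of_nonneg _ _ zero_le_two, mul_zero]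
  congr 1
  ring

lemma I2_diff_Omega1_of_lt {θ : ℝ} (hθ : θ < arctan (1 / 2)) :
    I2 \ Omega1 θ = {q ∈ I2 | 1 / 2 + (1 - q.1) * tan θ < q.2} := by
  have h : θ ≠ π / 2 := (hθ.trans (arctan_lt_pi_div_two _)).ne
  ext q
  simp only [Omega1, h, hθ, if_true, if_false, Set.mem_sdiff, Set.mem_ofPred_eq, not_and, not_le]
  constructor
  · exact fun ⟨h1, h2⟩ => ⟨h1, by linarith [h2 h1]⟩
  · exact fun ⟨h1, h2⟩ => ⟨h1, fun _ => by linarith⟩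

lemma half_le_tan {θ : ℝ} (hθ : arctan (1 / 2) ≤ θ) (hθ2 : θ < π / 2) : 1 / 2 ≤ tan θ := by
  have h := tan_arctan (1 / 2)
  rcases hθ.eq_or_lt with rfl | hlt
  · exact h.ge
  · exact h ▸ (tan_lt_tan_of_lt_of_lt_pi_div_two (neg_pi_div_two_lt_arctan _) hθ2 hlt).le

lemma cot_mem_Icc {θ : ℝ} (hθ : arctan (1 / 2) ≤ θ) (hθ2 : θ ≤ π / 2) :
    cot θ ∈ Set.Icc (0 : ℝ) 2 := by
  rcases hθ2.eq_or_lt with rfl | hlt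
  · simp [Real.cot_eq_cos_div_sin]
  · have := half_le_tan hθ hlt
    rw [← Real.tan_inv_eq_cot]
    exact ⟨inv_nonneg.2 (by linarith), (inv_le_comm₀ (by linarith) two_pos).2 (by linarith)⟩

lemma I2_diff_Omega1_of_ge {θ : ℝ} (hθ : arctan (1 / 2) ≤ θ) (hθ2 : θ ≤ π / 2) :
    I2 \ Omega1 θ = {q ∈ I2 | 1 + (1 / 2 - q.2) * cot θ < q.1} := by
  rcases hθ2.eq_or_lt with rfl | hlt
  · ext q
    simp only [Omega1, I2, if_true, Real.cot_eq_cos_div_sin, Real.cos_pi_div_two, zero_div,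
      mul_zero, add_zero, Set.mem_sdiff, Set.mem_prod, Set.mem_Icc, Set.mem_ofPred_eq]
    constructor
    · rintro ⟨h1, h2⟩
      refine ⟨h1, ?_⟩
      by_contra! h
      exact h2 ⟨⟨h1.1.1, h⟩, h1.2⟩
    · rintro ⟨h1, h2⟩
      exact ⟨h1, fun h => by linarith [h.1.2]⟩
  · have ht := half_le_tan hθ hlt
    have ht0 : 0 < tan θ := by linarith
    have key : ∀ q : ℝ × ℝ, (1 / 2 < (q.1 - 1) * tan θ + q.2 ↔ 1 + (1 / 2 - q.2) * cot θ < q.1) := by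
      intro q
      rw [← Real.tan_inv_eq_cot, ← div_eq_mul_inv, ← lt_sub_iff_add_lt', div_lt_iff₀ ht0]
      constructor <;> intro h <;> linarith
    ext q
    simp only [Omega1, hlt.ne, hθ.not_gt, if_false, Set.mem_sdiff, Set.mem_ofPred_eq, not_and, not_le]
    rw [← key]
    exact ⟨fun ⟨h1, h2⟩ => ⟨h1, h2 h1⟩, fun ⟨h1, h2⟩ => ⟨h1, fun _ => h2⟩⟩

lemma Omega1_subset_I2 (θ : ℝ) : Omega1 θ ⊆ I2 := by
  unfold Omega1
  split_ifs
  · exact Set.prod_mono (Set.Icc_subset_Icc_right one_le_two) subset_rfl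
  · exact fun q hq => hq.1
  · exact fun q hq => hq.1

lemma measurableSet_I2 : MeasurableSet I2 := measurableSet_Icc.prod measurableSet_Icc

lemma isClosed_I2 : IsClosed I2 := isClosed_Icc.prod isClosed_Icc

lemma convex_I2 : Convex ℝ I2 := (convex_Icc _ _).prod (convex_Icc _ _)

lemma measurableSet_Omega1 (θ : ℝ) : MeasurableSet (Omega1 θ) := by
  unfold Omega1
  split_ifs
  · exact measurableSet_Icc.prod measurableSet_Icc
  · exact measurableSet_I2.inter (measurableSet_le (f := fun p : ℝ × ℝ => p.2)
      (g := fun p => (1 - p.1) * tan θ + 1 / 2) (by fun_prop) (by fun_prop))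
  · exact measurableSet_I2.inter (measurableSet_le (f := fun p : ℝ × ℝ => (p.1 - 1) * tan θ + p.2)
      (g := fun _ => 1 / 2) (by fun_prop) (by fun_prop))

lemma measurableSet_Omega2 (θ : ℝ) : MeasurableSet (Omega2 θ) := isClosed_closure.measurableSet

lemma Omega2_subset_I2 (θ : ℝ) : Omega2 θ ⊆ I2 :=
  closure_minimal Set.sdiff_subset isClosed_I2

lemma I2_subset_union (θ : ℝ) : I2 ⊆ Omega1 θ ∪ Omega2 θ := fun q hq => by
  by_cases h : q ∈ Omega1 θ
  · exact Or.inl h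
  · exact Or.inr (subset_closure ⟨hq, h⟩)

lemma convex_I2_diff_Omega1 {θ : ℝ} (hθ : θ ∈ Set.Icc 0 (π / 2)) : Convex ℝ (I2 \ Omega1 θ) := by
  rcases lt_or_ge θ (arctan (1 / 2)) with h | h
  · rw [I2_diff_Omega1_of_lt h]
    refine fun x hx y hy a b ha hb hab => ⟨convex_I2 hx.1 hy.1 ha hb hab, ?_⟩
    have h1 := hx.2
    have h2 := hy.2
    simp only [Prod.fst_add, Prod.smul_fst, Prod.snd_add, Prod.smul_snd, smul_eq_mul]
    obtain rfl : b = 1 - a := by linarith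
    rcases ha.eq_or_lt with rfl | ha
    · linarith
    · nlinarith [mul_lt_mul_of_pos_left h1 ha, mul_le_mul_of_nonneg_left h2.le hb]
  · rw [I2_diff_Omega1_of_ge h hθ.2]
    refine fun x hx y hy a b ha hb hab => ⟨convex_I2 hx.1 hy.1 ha hb hab, ?_⟩
    have h1 := hx.2
    have h2 := hy.2
    simp only [Prod.fst_add, Prod.smul_fst, Prod.snd_add, Prod.smul_snd, smul_eq_mul]
    obtain rfl : b = 1 - a := by linarith
    rcases ha.eq_or_lt with rfl | ha
    · linarith
    · nlinarith [mul_lt_mul_of_pos_left h1 ha, mul_le_mul_of_nonneg_left h2.le hb]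

lemma Omega2_ae_eq {θ : ℝ} (hθ : θ ∈ Set.Icc 0 (π / 2)) :
    Omega2 θ =ᵐ[volume] (I2 \ Omega1 θ : Set (ℝ × ℝ)) :=
  closure_ae_eq_of_null_frontier ((convex_I2_diff_Omega1 hθ).addHaar_frontier _)

/-- The area of the part of `W` lying strictly below and to the left of `p`. -/
noncomputable def cornerArea (W : Set (ℝ × ℝ)) (p : ℝ × ℝ) : ℝ :=
  volume.real (W ∩ Set.Iio p.1 ×ˢ Set.Iio p.2)

lemma cornerArea_congr {W W' : Set (ℝ × ℝ)} (h : W =ᵐ[volume] W') : cornerArea W = cornerArea W' :=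
  funext fun _ => measureReal_congr (h.inter (Filter.EventuallyEq.refl _ _))

lemma cornerArea_I2 {p : ℝ × ℝ} (hp : p ∈ I2) : cornerArea I2 p = p.1 * p.2 := by
  obtain ⟨⟨hp1, hp2⟩, hp3, hp4⟩ := hp
  have : I2 ∩ Set.Iio p.1 ×ˢ Set.Iio p.2 = Set.Ico 0 p.1 ×ˢ Set.Ico 0 p.2 := by
    ext ⟨x, y⟩
    simp only [I2, Set.mem_inter_iff, Set.mem_prod, Set.mem_Icc, Set.mem_Iio, Set.mem_Ico]
    constructor
    · rintro ⟨⟨⟨h1, h2⟩, h3, h4⟩, h5, h6⟩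
      exact ⟨⟨h1, h5⟩, h3, h6⟩
    · rintro ⟨⟨h1, h2⟩, h3, h4⟩
      exact ⟨⟨⟨h1, by linarith⟩, h3, by linarith⟩, h2, h4⟩
  rw [cornerArea, this, Measure.volume_eq_prod, measureReal_prod_prod]
  simp [hp1, hp3]

lemma volume_I2 : volume I2 = 2 := by
  rw [I2, Measure.volume_eq_prod, Measure.prod_prod]
  simp

lemma cornerArea_Omega1 {θ : ℝ} {p : ℝ × ℝ} (hp : p ∈ I2) :
    cornerArea (Omega1 θ) p = p.1 * p.2 - cornerArea (I2 \ Omega1 θ) p := by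
  have hfin : volume (I2 ∩ Set.Iio p.1 ×ˢ Set.Iio p.2) ≠ ⊤ :=
    measure_ne_top_of_subset Set.inter_subset_left (by simp [volume_I2])
  have h := measureReal_inter_add_sdiff (μ := volume) (s := I2 ∩ Set.Iio p.1 ×ˢ Set.Iio p.2)
    (measurableSet_Omega1 θ) hfin
  rw [← cornerArea_I2 hp, cornerArea, cornerArea, cornerArea, ← h]
  have e1 : I2 ∩ Set.Iio p.1 ×ˢ Set.Iio p.2 ∩ Omega1 θ = Omega1 θ ∩ Set.Iio p.1 ×ˢ Set.Iio p.2 := by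
    ext q
    have := @Omega1_subset_I2 θ q
    simp only [Set.mem_inter_iff]
    tauto
  have e2 : (I2 ∩ Set.Iio p.1 ×ˢ Set.Iio p.2) \ Omega1 θ
      = (I2 \ Omega1 θ) ∩ Set.Iio p.1 ×ˢ Set.Iio p.2 := by
    ext q
    simp only [Set.mem_inter_iff, Set.mem_sdiff]
    tauto
  rw [e1, e2]
  ring

/-- Each member of the family is, up to rescaling and swapping the coordinates, cut out by a line
through the centre of the unit square. -/
lemma exists_cornerArea_eq {θ : ℝ} (hθ : θ ∈ Set.Icc 0 (π / 2)) :
    ∃ s : ℝ, 0 ≤ s ∧ s ≤ 1 ∧ s / 12 - s ^ 2 / 30 - s ^ 3 / 180 = -Pfun θ ∧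
      ((∀ p ∈ I2, cornerArea (I2 \ Omega1 θ) p = 2 * aboveArea s (p.1 / 2) p.2) ∨
       (∀ p ∈ I2, cornerArea (I2 \ Omega1 θ) p = 2 * aboveArea s p.2 (p.1 / 2))) := by
  rcases lt_or_ge θ (arctan (1 / 2)) with h | h
  · have ht0 : 0 ≤ tan θ := tan_nonneg_of_nonneg_of_le_pi_div_two hθ.1 hθ.2
    have ht1 : tan θ ≤ 1 / 2 := by
      have := tan_lt_tan_of_lt_of_lt_pi_div_two (by linarith [hθ.1, pi_pos])
        (arctan_lt_pi_div_two _) h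
      rw [tan_arctan] at this
      exact this.le
    refine ⟨2 * tan θ, by linarith, by linarith, ?_, Or.inl fun p hp => ?_⟩
    · simp only [Pfun, h, if_true]
      ring
    · rw [I2_diff_Omega1_of_lt h]
      exact real_volume_above ht0 ht1 hp
  · obtain ⟨hc0, hc2⟩ := cot_mem_Icc h hθ.2
    refine ⟨cot θ / 2, by linarith, by linarith, ?_, Or.inr fun p hp => ?_⟩
    · simp only [Pfun, h.not_gt, if_false]
      split_ifs with heq
      · rw [← Real.tan_inv_eq_cot, heq, tan_arctan]
        norm_num
      · ring
    · rw [I2_diff_Omega1_of_ge h hθ.2]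
      exact real_volume_right hc0 hc2 hp

lemma I2_inter_Iio_ae_eq : (I2 ∩ Set.Iio (2 : ℝ) ×ˢ Set.Iio (1 : ℝ) : Set (ℝ × ℝ)) =ᵐ[volume] I2 := by
  have : I2 ∩ Set.Iio (2 : ℝ) ×ˢ Set.Iio (1 : ℝ) = Set.Ico 0 2 ×ˢ Set.Ico 0 1 := by
    rw [I2, Set.prod_inter_prod]
    congr 1 <;> ext x <;> simp only [Set.mem_inter_iff, Set.mem_Icc, Set.mem_Iio, Set.mem_Ico] <;>
      constructor <;> intro h <;> simp_all <;> linarith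
  rw [this, I2]
  exact Measure.set_prod_ae_eq Ico_ae_eq_Icc Ico_ae_eq_Icc

lemma cornerArea_top {W : Set (ℝ × ℝ)} (hW : W ⊆ I2) : cornerArea W (2, 1) = volume.real W := by
  refine measureReal_congr ?_
  have h := (Filter.EventuallyEq.refl (ae volume) W).inter I2_inter_Iio_ae_eq
  rwa [← Set.inter_assoc, Set.inter_eq_left.2 hW] at h

lemma real_volume_I2_diff_Omega1 {θ : ℝ} (hθ : θ ∈ Set.Icc 0 (π / 2)) :
    volume.real (I2 \ Omega1 θ) = 1 := by
  have hmem : ((2 : ℝ), (1 : ℝ)) ∈ I2 := by simp [I2]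
  obtain ⟨s, hs0, hs1, -, h | h⟩ := exists_cornerArea_eq hθ <;>
    rw [← cornerArea_top Set.sdiff_subset, h _ hmem] <;>
    norm_num [aboveArea_one_one hs0 hs1]

lemma real_volume_Omega2 {θ : ℝ} (hθ : θ ∈ Set.Icc 0 (π / 2)) : volume.real (Omega2 θ) = 1 := by
  rw [measureReal_congr (Omega2_ae_eq hθ), real_volume_I2_diff_Omega1 hθ]

lemma real_volume_Omega1 {θ : ℝ} (hθ : θ ∈ Set.Icc 0 (π / 2)) : volume.real (Omega1 θ) = 1 := by
  have hmem : ((2 : ℝ), (1 : ℝ)) ∈ I2 := by simp [I2]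
  rw [← cornerArea_top (Omega1_subset_I2 θ), cornerArea_Omega1 hmem,
    cornerArea_top Set.sdiff_subset, real_volume_I2_diff_Omega1 hθ]
  norm_num

lemma measurable_cornerArea {W : Set (ℝ × ℝ)} (hW : MeasurableSet W) :
    Measurable (cornerArea W) := by
  have h : MeasurableSet {q : (ℝ × ℝ) × (ℝ × ℝ) | q.2 ∈ W ∧ q.2.1 < q.1.1 ∧ q.2.2 < q.1.2} :=
    (measurable_snd hW).inter
      ((measurableSet_lt (measurable_fst.comp measurable_snd) (measurable_fst.comp measurable_fst)).inter
      (measurableSet_lt (measurable_snd.comp measurable_snd) (measurable_snd.comp measurable_fst)))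
  exact (measurable_measure_prodMk_left (ν := (volume : Measure (ℝ × ℝ))) h).ennreal_toReal

lemma cornerArea_nonneg (W : Set (ℝ × ℝ)) (p : ℝ × ℝ) : 0 ≤ cornerArea W p := measureReal_nonneg

lemma cornerArea_le {W : Set (ℝ × ℝ)} (hW : W ⊆ I2) (p : ℝ × ℝ) : cornerArea W p ≤ 2 := by
  have : volume.real I2 = 2 := by simp [measureReal_def, volume_I2]
  rw [← this]
  exact measureReal_mono (Set.inter_subset_left.trans hW) (by simp [volume_I2])

lemma integrableOn_cornerArea_sq {W : Set (ℝ × ℝ)} (hW : MeasurableSet W) (hWI : W ⊆ I2)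
    {s : Set (ℝ × ℝ)} (hs : volume s ≠ ⊤) : IntegrableOn (fun p => cornerArea W p ^ 2) s := by
  refine IntegrableOn.of_bound hs.lt_top
    ((measurable_cornerArea hW).pow_const 2).aestronglyMeasurable (2 ^ 2)
    (Filter.Eventually.of_forall fun p => ?_)
  rw [Real.norm_of_nonneg (sq_nonneg _)]
  exact pow_le_pow_left₀ (cornerArea_nonneg _ _) (cornerArea_le hWI p) 2

lemma integral_aboveArea_rescaled {s : ℝ} (hs : 0 ≤ s) (hs1 : s ≤ 1) :
    ∫ x in (0 : ℝ)..2, ∫ y in (0 : ℝ)..1,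
      ((x * y - 2 * aboveArea s (x / 2) y) ^ 2 + (2 * aboveArea s (x / 2) y) ^ 2)
      = 5 / 9 + s / 12 - s ^ 2 / 30 - s ^ 3 / 180 := by
  have h := intervalIntegral.integral_comp_div (a := 0) (b := 2)
    (fun u => ∫ v in (0 : ℝ)..1, ((u * v - aboveArea s u v) ^ 2 + aboveArea s u v ^ 2))
    (two_ne_zero (α := ℝ))
  rw [zero_div, div_self two_ne_zero, integral_aboveArea hs hs1, smul_eq_mul] at h
  have h4 : ∀ x y : ℝ, (x * y - 2 * aboveArea s (x / 2) y) ^ 2 + (2 * aboveArea s (x / 2) y) ^ 2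
      = 4 * ((x / 2 * y - aboveArea s (x / 2) y) ^ 2 + aboveArea s (x / 2) y ^ 2) := by
    intro x y
    ring
  simp only [h4, intervalIntegral.integral_const_mul, h]
  ring

lemma integral_aboveArea_rescaled_swap {s : ℝ} (hs : 0 ≤ s) (hs1 : s ≤ 1) :
    ∫ y in (0 : ℝ)..1, ∫ x in (0 : ℝ)..2,
      ((x * y - 2 * aboveArea s y (x / 2)) ^ 2 + (2 * aboveArea s y (x / 2)) ^ 2)
      = 5 / 9 + s / 12 - s ^ 2 / 30 - s ^ 3 / 180 := by
  have h : ∀ y : ℝ, ∫ x in (0 : ℝ)..2,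
      ((x * y - 2 * aboveArea s y (x / 2)) ^ 2 + (2 * aboveArea s y (x / 2)) ^ 2)
      = 8 * ∫ x in (0 : ℝ)..1, ((y * x - aboveArea s y x) ^ 2 + aboveArea s y x ^ 2) := by
    intro y
    have h := intervalIntegral.integral_comp_div (a := 0) (b := 2)
      (fun x => (y * x - aboveArea s y x) ^ 2 + aboveArea s y x ^ 2) (two_ne_zero (α := ℝ))
    rw [zero_div, div_self two_ne_zero, smul_eq_mul] at h
    have h4 : ∀ x : ℝ, (x * y - 2 * aboveArea s y (x / 2)) ^ 2 + (2 * aboveArea s y (x / 2)) ^ 2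
        = 4 * ((y * (x / 2) - aboveArea s y (x / 2)) ^ 2 + aboveArea s y (x / 2) ^ 2) := by
      intro x
      ring
    simp only [h4, intervalIntegral.integral_const_mul, h]
    ring
  simp only [h, intervalIntegral.integral_const_mul, integral_aboveArea hs hs1]
  ring

lemma integral_cornerArea_sq_add {θ : ℝ} (hθ : θ ∈ Set.Icc 0 (π / 2)) :
    (∫ p in Set.Ioc (0 : ℝ) 2 ×ˢ Set.Ioc (0 : ℝ) 1, cornerArea (Omega1 θ) p ^ 2)
      + (∫ p in Set.Ioc (0 : ℝ) 2 ×ˢ Set.Ioc (0 : ℝ) 1, cornerArea (Omega2 θ) p ^ 2)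
      = 5 / 9 - Pfun θ := by
  have hsub : Set.Ioc (0 : ℝ) 2 ×ˢ Set.Ioc (0 : ℝ) 1 ⊆ I2 :=
    Set.prod_mono Set.Ioc_subset_Icc_self Set.Ioc_subset_Icc_self
  have hfin : volume (Set.Ioc (0 : ℝ) 2 ×ˢ Set.Ioc (0 : ℝ) 1) ≠ ⊤ :=
    measure_ne_top_of_subset hsub (by simp [volume_I2])
  have hms : MeasurableSet (Set.Ioc (0 : ℝ) 2 ×ˢ Set.Ioc (0 : ℝ) 1) :=
    measurableSet_Ioc.prod measurableSet_Ioc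
  rw [cornerArea_congr (Omega2_ae_eq hθ),
    ← integral_add (integrableOn_cornerArea_sq (measurableSet_Omega1 θ) (Omega1_subset_I2 θ) hfin)
      (integrableOn_cornerArea_sq (measurableSet_I2.diff (measurableSet_Omega1 θ))
        Set.sdiff_subset hfin)]
  have hcont : ∀ k : ℝ × ℝ → ℝ, Continuous k → IntegrableOn
      (fun p : ℝ × ℝ => (p.1 * p.2 - 2 * k p) ^ 2 + (2 * k p) ^ 2)
      (Set.Ioc (0 : ℝ) 2 ×ˢ Set.Ioc (0 : ℝ) 1) (volume.prod volume) := fun k hk =>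
    (ContinuousOn.integrableOn_compact (K := I2) (isCompact_Icc.prod isCompact_Icc)
      (by fun_prop)).mono_set hsub
  obtain ⟨s, hs0, hs1, hP, h | h⟩ := exists_cornerArea_eq hθ
  · rw [setIntegral_congr_fun (g := fun p => (p.1 * p.2 - 2 * aboveArea s (p.1 / 2) p.2) ^ 2
        + (2 * aboveArea s (p.1 / 2) p.2) ^ 2) hms
      (fun p hp => by simp only [cornerArea_Omega1 (hsub hp), h p (hsub hp)]),
      Measure.volume_eq_prod, setIntegral_prod _ (hcont (fun p => aboveArea s (p.1 / 2) p.2)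
        ((continuous_aboveArea s).comp (f := fun p : ℝ × ℝ => (p.1 / 2, p.2)) (by fun_prop)))]
    have := integral_aboveArea_rescaled hs0 hs1
    simp only [intervalIntegral.integral_of_le zero_le_two,
      intervalIntegral.integral_of_le zero_le_one] at this
    rw [this]
    linarith
  · rw [setIntegral_congr_fun (g := fun p => (p.1 * p.2 - 2 * aboveArea s p.2 (p.1 / 2)) ^ 2
        + (2 * aboveArea s p.2 (p.1 / 2)) ^ 2) hms
      (fun p hp => by simp only [cornerArea_Omega1 (hsub hp), h p (hsub hp)]),
      Measure.volume_eq_prod, ← Measure.prod_restrict, integral_prod_symm]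
    · have := integral_aboveArea_rescaled_swap hs0 hs1
      simp only [intervalIntegral.integral_of_le zero_le_two,
        intervalIntegral.integral_of_le zero_le_one] at this
      rw [this]
      linarith
    · rw [Measure.prod_restrict]
      exact hcont (fun p => aboveArea s p.2 (p.1 / 2)) ((continuous_aboveArea s).comp
        (f := fun p : ℝ × ℝ => (p.2, p.1 / 2)) (by fun_prop))

lemma measurableSet_unitCube (d : ℕ) : MeasurableSet (unitCube d) :=
  MeasurableSet.univ_pi fun _ => measurableSet_Icc

lemma volume_unitCube (d : ℕ) : volume (unitCube d) = 1 := by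
  rw [unitCube, volume_pi_pi]
  simp

lemma lowerBox_eq_pi {d : ℕ} (z : Fin d → ℝ) :
    lowerBox z = Set.univ.pi fun i => Set.Ico 0 (z i) := by
  ext y
  simp [lowerBox]

lemma measurableSet_lowerBox {d : ℕ} (z : Fin d → ℝ) : MeasurableSet (lowerBox z) := by
  rw [lowerBox_eq_pi]
  exact MeasurableSet.univ_pi fun _ => measurableSet_Ico

lemma lowerBox_subset {d : ℕ} {z : Fin d → ℝ} (hz : z ∈ unitCube d) :
    lowerBox z ⊆ Set.univ.pi fun _ => Set.Ico (0 : ℝ) 1 := fun _ hy i _ =>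
  ⟨(hy i).1, (hy i).2.trans_le (hz i trivial).2⟩

lemma volume_pi_Ico_zero_one (d : ℕ) :
    volume (Set.univ.pi fun _ : Fin d => Set.Ico (0 : ℝ) 1) = 1 := by
  simp [volume_pi_pi]

lemma measurableSet_mem_lowerBox (d : ℕ) :
    MeasurableSet {q : (Fin d → ℝ) × (Fin d → ℝ) | q.2 ∈ lowerBox q.1} := by
  have : {q : (Fin d → ℝ) × (Fin d → ℝ) | q.2 ∈ lowerBox q.1}
      = ⋂ i, {q : (Fin d → ℝ) × (Fin d → ℝ) | 0 ≤ q.2 i} ∩ {q | q.2 i < q.1 i} := by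
    ext q
    simp [lowerBox]
  rw [this]
  refine MeasurableSet.iInter fun i => (measurableSet_le (f := fun _ => (0 : ℝ))
    (g := fun q : (Fin d → ℝ) × (Fin d → ℝ) => q.2 i) (by fun_prop) (by fun_prop)).inter
    (measurableSet_lt (f := fun q : (Fin d → ℝ) × (Fin d → ℝ) => q.2 i)
    (g := fun q : (Fin d → ℝ) × (Fin d → ℝ) => q.1 i) (by fun_prop) (by fun_prop))

lemma measurable_real_inter_lowerBox {d : ℕ} {A : Set (Fin d → ℝ)} (hA : MeasurableSet A) :
    Measurable fun z => volume.real (A ∩ lowerBox z) := by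
  have h : MeasurableSet {q : (Fin d → ℝ) × (Fin d → ℝ) | q.2 ∈ A ∧ q.2 ∈ lowerBox q.1} :=
    (measurable_snd hA).inter (measurableSet_mem_lowerBox d)
  exact (measurable_measure_prodMk_left (ν := (volume : Measure (Fin d → ℝ))) h).ennreal_toReal

lemma real_inter_lowerBox_le_one {d : ℕ} (A : Set (Fin d → ℝ)) {z : Fin d → ℝ}
    (hz : z ∈ unitCube d) : volume.real (A ∩ lowerBox z) ≤ 1 := by
  have h1 : volume.real (Set.univ.pi fun _ : Fin d => Set.Ico (0 : ℝ) 1) = 1 := by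
    rw [measureReal_def, volume_pi_Ico_zero_one, ENNReal.toReal_one]
  rw [← h1]
  exact measureReal_mono (Set.inter_subset_right.trans (lowerBox_subset hz))
    (by simp [volume_pi_Ico_zero_one])

lemma integrableOn_real_inter_lowerBox_pow {d : ℕ} {A : Set (Fin d → ℝ)} (hA : MeasurableSet A)
    (n : ℕ) : IntegrableOn (fun z => volume.real (A ∩ lowerBox z) ^ n) (unitCube d) := by
  refine IntegrableOn.of_bound (by simp [volume_unitCube])
    ((measurable_real_inter_lowerBox hA).pow_const n).aestronglyMeasurable 1
    ((ae_restrict_mem (measurableSet_unitCube d)).mono fun z hz => ?_)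
  rw [Real.norm_of_nonneg (pow_nonneg measureReal_nonneg n)]
  exact pow_le_one₀ measureReal_nonneg (real_inter_lowerBox_le_one A hz)

section Stratified

variable {d : ℕ} {ι : Type} [Fintype ι] [Nonempty ι] {Ω : ι → Set (Fin d → ℝ)}

/-- Cells of measure `1/N` that cover the cube must tile it up to null sets. -/
lemma sum_real_inter_lowerBox
    (hvol : ∀ i, volume.real (Ω i) = (Fintype.card ι : ℝ)⁻¹)
    (hcover : (Set.univ.pi fun _ => Set.Ico (0 : ℝ) 1) ⊆ ⋃ i, Ω i)
    {z : Fin d → ℝ} (hz : z ∈ unitCube d) :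
    ∑ i, volume.real (Ω i ∩ lowerBox z) = volume.real (lowerBox z) := by
  set C : Set (Fin d → ℝ) := Set.univ.pi fun _ => Set.Ico (0 : ℝ) 1 with hC
  have hN : (Fintype.card ι : ℝ) ≠ 0 := Nat.cast_ne_zero.2 Fintype.card_ne_zero
  have hfin : ∀ i, volume (Ω i) ≠ ⊤ := fun i h => by
    have := hvol i
    rw [measureReal_def, h, ENNReal.toReal_top] at this
    exact inv_ne_zero hN this.symm
  have hL := measurableSet_lowerBox z
  have hLC : lowerBox z ⊆ C := lowerBox_subset hz
  have hCfin : volume C ≠ ⊤ := by simp [hC, volume_pi_Ico_zero_one]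
  have hle : ∀ A ⊆ C, volume.real A ≤ ∑ i, volume.real (Ω i ∩ A) := fun A hA => by
    have : A = ⋃ i, Ω i ∩ A := by
      rw [← Set.iUnion_inter, Set.inter_eq_right.2 (hA.trans hcover)]
    calc volume.real A = volume.real (⋃ i, Ω i ∩ A) := by rw [← this]
      _ ≤ _ := measureReal_iUnion_fintype_le _
  have h1 := hle _ hLC
  have h2 := hle (C \ lowerBox z) Set.sdiff_subset
  have h3 : volume.real (C \ lowerBox z) = 1 - volume.real (lowerBox z) := by
    rw [measureReal_sdiff hLC hL hCfin, measureReal_def, volume_pi_Ico_zero_one,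
      ENNReal.toReal_one]
  have h4 : ∑ i, volume.real (Ω i ∩ (C \ lowerBox z))
      ≤ ∑ i, volume.real (Ω i \ lowerBox z) := by
    refine Finset.sum_le_sum fun i _ => measureReal_mono (fun x hx => ⟨hx.1, hx.2.2⟩)
      (measure_ne_top_of_subset Set.sdiff_subset (hfin i))
  have h5 : ∑ i, volume.real (Ω i ∩ lowerBox z) + ∑ i, volume.real (Ω i \ lowerBox z) = 1 := by
    rw [← Finset.sum_add_distrib]
    simp only [measureReal_inter_add_sdiff hL (hfin _), hvol, Finset.sum_const,
      Finset.card_univ, nsmul_eq_mul]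
    exact mul_inv_cancel₀ hN
  linarith

open ProbabilityTheory in
lemma integral_stratified_sq
    (hmeas : ∀ i, MeasurableSet (Ω i)) (hvol : ∀ i, volume.real (Ω i) = (Fintype.card ι : ℝ)⁻¹)
    (hcover : (Set.univ.pi fun _ => Set.Ico (0 : ℝ) 1) ⊆ ⋃ i, Ω i)
    {z : Fin d → ℝ} (hz : z ∈ unitCube d) :
    ∫ P, (volume.real (lowerBox z) - (Fintype.card ι : ℝ)⁻¹
        * ∑ i, (lowerBox z).indicator (fun _ => (1 : ℝ)) (P i)) ^ 2 ∂(stratified Ω)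
      = (Fintype.card ι : ℝ)⁻¹ * volume.real (lowerBox z)
        - ∑ i, volume.real (Ω i ∩ lowerBox z) ^ 2 := by
  have hN : (Fintype.card ι : ℝ) ≠ 0 := Nat.cast_ne_zero.2 Fintype.card_ne_zero
  have hprob : ∀ i, IsProbabilityMeasure (cond volume (Ω i)) := fun i => by
    refine cond_isProbabilityMeasure_of_finite (fun h => ?_) (fun h => ?_) <;>
    · have := hvol i
      rw [measureReal_def, h] at this
      exact inv_ne_zero hN this.symm
  have hL := measurableSet_lowerBox z
  set X : (Fin d → ℝ) → ℝ := (lowerBox z).indicator fun _ => (1 : ℝ) with hX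
  have hXm : Measurable X := measurable_const.indicator hL
  have hXLp : ∀ i, MemLp X 2 (cond volume (Ω i)) := fun i =>
    MemLp.of_bound hXm.aestronglyMeasurable 1 (Filter.Eventually.of_forall fun x => by
      by_cases hx : x ∈ lowerBox z <;> simp [hX, hx])
  have hmean : ∀ i, ∫ x, X x ∂(cond volume (Ω i))
      = Fintype.card ι * volume.real (Ω i ∩ lowerBox z) := fun i => by
    rw [hX, integral_indicator_const _ hL, measureReal_def, cond_apply (hmeas i),
      ENNReal.toReal_mul, ENNReal.toReal_inv, ← measureReal_def, ← measureReal_def, hvol, inv_inv,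
      smul_eq_mul, mul_one]
  have hvar : ∀ i, Var[X; cond volume (Ω i)]
      = Fintype.card ι * volume.real (Ω i ∩ lowerBox z)
        - (Fintype.card ι * volume.real (Ω i ∩ lowerBox z)) ^ 2 := fun i => by
    have hsq : X ^ 2 = X := by
      ext x
      by_cases hx : x ∈ lowerBox z <;> simp [hX, hx]
    rw [variance_eq_sub (hXLp i), hsq, hmean]
  have hsum := variance_sum_pi (X := fun _ : ι => X) hXLp
  have hSm : Measurable (∑ i, fun P : ι → Fin d → ℝ => X (P i)) := by
    rw [Finset.sum_fn]
    exact Finset.measurable_sum _ fun i _ => hXm.comp (measurable_pi_apply i)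
  have hES : ∫ P, (∑ i, fun P : ι → Fin d → ℝ => X (P i)) P ∂(stratified Ω)
      = Fintype.card ι * volume.real (lowerBox z) := by
    simp only [Finset.sum_apply]
    rw [integral_finsetSum]
    · rw [← sum_real_inter_lowerBox hvol hcover hz, Finset.mul_sum]
      refine Finset.sum_congr rfl fun i _ => ?_
      rw [← hmean, stratified]
      have hmp := measurePreserving_eval (fun i => cond volume (Ω i)) i
      exact (integral_map hmp.measurable.aemeasurable hXm.aestronglyMeasurable).symm.trans
        (by rw [hmp.map_eq])
    · intro i _
      exact ((measurePreserving_eval (fun i => cond volume (Ω i)) i).integrable_comp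
        hXm.aestronglyMeasurable).2 ((hXLp i).integrable one_le_two)
  rw [variance_eq_integral hSm.aemeasurable] at hsum
  change ∫ P, _ ∂(stratified Ω) = _ at hsum
  have hscale : ∀ P : ι → Fin d → ℝ, (volume.real (lowerBox z)
      - (Fintype.card ι : ℝ)⁻¹ * ∑ i, X (P i)) ^ 2
      = ((Fintype.card ι : ℝ)⁻¹) ^ 2 * ((∑ i, fun P : ι → Fin d → ℝ => X (P i)) P
        - Fintype.card ι * volume.real (lowerBox z)) ^ 2 := fun P => by
    rw [Finset.sum_apply]
    field_simp
    ring
  simp only [hscale, integral_const_mul]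
  rw [show Measure.pi (fun i => cond volume (Ω i)) = stratified Ω from rfl, hES] at hsum
  rw [hsum, ← sum_real_inter_lowerBox hvol hcover hz]
  simp only [hvar, Finset.mul_sum, ← Finset.sum_sub_distrib]
  refine Finset.sum_congr rfl fun i _ => ?_
  field_simp

lemma expL2sq_eq
    (hmeas : ∀ i, MeasurableSet (Ω i)) (hvol : ∀ i, volume.real (Ω i) = (Fintype.card ι : ℝ)⁻¹)
    (hcover : (Set.univ.pi fun _ => Set.Ico (0 : ℝ) 1) ⊆ ⋃ i, Ω i) :
    expL2sq Ω = (∫ z in unitCube d, (Fintype.card ι : ℝ)⁻¹ * volume.real (lowerBox z))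
      - ∑ i, ∫ z in unitCube d, volume.real (Ω i ∩ lowerBox z) ^ 2 := by
  classical
  have hN : (Fintype.card ι : ℝ) ≠ 0 := Nat.cast_ne_zero.2 Fintype.card_ne_zero
  have hN0 : (0 : ℝ) < Fintype.card ι := Nat.cast_pos.2 Fintype.card_pos
  have hprob : ∀ i, IsProbabilityMeasure (ProbabilityTheory.cond volume (Ω i)) := fun i => by
    refine ProbabilityTheory.cond_isProbabilityMeasure_of_finite (fun h => ?_) (fun h => ?_) <;>
    · have := hvol i
      rw [measureReal_def, h] at this
      exact inv_ne_zero hN this.symm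
  have hprob' : IsProbabilityMeasure (stratified Ω) :=
    inferInstanceAs (IsProbabilityMeasure (Measure.pi _))
  have hcube : IsFiniteMeasure (volume.restrict (unitCube d)) :=
    ⟨by simp [volume_unitCube]⟩
  have hcard : ∀ (P : ι → Fin d → ℝ) (z : Fin d → ℝ), (Nat.card {i // P i ∈ lowerBox z} : ℝ)
      = ∑ i, (lowerBox z).indicator (fun _ => (1 : ℝ)) (P i) := fun P z => by
    rw [Nat.card_eq_fintype_card, Fintype.card_subtype, Finset.card_filter, Nat.cast_sum]
    refine Finset.sum_congr rfl fun i _ => ?_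
    by_cases h : P i ∈ lowerBox z <;> simp [h]
  simp only [expL2sq, L2sq, hcard, ← measureReal_def]
  rw [integral_integral_swap]
  · rw [setIntegral_congr_fun (measurableSet_unitCube d)
      (fun z hz => integral_stratified_sq hmeas hvol hcover hz), integral_sub,
      integral_finsetSum]
    · exact fun i _ => integrableOn_real_inter_lowerBox_pow (hmeas i) 2
    · have := integrableOn_real_inter_lowerBox_pow (d := d) MeasurableSet.univ 1
      simp only [Set.univ_inter, pow_one] at this
      exact this.const_mul _
    · exact integrable_finsetSum _ fun i _ => integrableOn_real_inter_lowerBox_pow (hmeas i) 2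
  · have hm : Measurable fun q : (ι → Fin d → ℝ) × (Fin d → ℝ) =>
        (volume.real (lowerBox q.2) - (Fintype.card ι : ℝ)⁻¹
          * ∑ i, (lowerBox q.2).indicator (fun _ => (1 : ℝ)) (q.1 i)) ^ 2 := by
      have h1 := measurable_real_inter_lowerBox (d := d) MeasurableSet.univ
      simp only [Set.univ_inter] at h1
      refine ((h1.comp measurable_snd).sub ((Finset.measurable_sum _ fun i _ => ?_).const_mul _)).pow_const 2
      exact (measurable_const (a := (1 : ℝ))).indicator
        ((measurableSet_mem_lowerBox d).preimage
          (measurable_snd.prodMk ((measurable_pi_apply i).comp measurable_fst)))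
    refine Integrable.of_bound hm.aestronglyMeasurable 1 ?_
    have hae : ∀ᵐ q ∂((stratified Ω).prod (volume.restrict (unitCube d))), q.2 ∈ unitCube d :=
      Measure.quasiMeasurePreserving_snd.ae (ae_restrict_mem (measurableSet_unitCube d))
    filter_upwards [hae] with q hq
    have h1 : volume.real (lowerBox q.2) ≤ 1 := by
      simpa using real_inter_lowerBox_le_one Set.univ hq
    have h0 : 0 ≤ volume.real (lowerBox q.2) := measureReal_nonneg
    have hs0 : 0 ≤ (Fintype.card ι : ℝ)⁻¹
        * ∑ i, (lowerBox q.2).indicator (fun _ => (1 : ℝ)) (q.1 i) :=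
      mul_nonneg (inv_nonneg.2 hN0.le) (Finset.sum_nonneg fun i _ =>
        Set.indicator_nonneg (fun _ _ => zero_le_one) _)
    have hs1 : (Fintype.card ι : ℝ)⁻¹
        * ∑ i, (lowerBox q.2).indicator (fun _ => (1 : ℝ)) (q.1 i) ≤ 1 := by
      rw [inv_mul_le_iff₀ hN0, mul_one]
      refine (Finset.sum_le_card_nsmul _ _ 1 fun i _ => ?_).trans_eq (by simp)
      exact Set.indicator_le_self' (fun _ _ => zero_le_one) _
    rw [Function.uncurry, Real.norm_of_nonneg (sq_nonneg _), sq_le_one_iff_abs_le_one, abs_le]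
    constructor <;> linarith

end Stratified

/-- The affine map sending the corner block of the grid to `[0,2] × [0,1]^(d-1)`. -/
noncomputable def rescale (m d : ℕ) (z : Fin d → ℝ) : Fin d → ℝ := (m : ℝ) • (z - anchor m d)

lemma continuous_rescale (m d : ℕ) : Continuous (rescale m d) := by
  unfold rescale
  fun_prop

lemma rescale_zero {m n : ℕ} (hm : m ≠ 0) (z : Fin (n + 2) → ℝ) :
    rescale m (n + 2) z 0 = m * z 0 - (m - 2) := by
  have : (m : ℝ) ≠ 0 := Nat.cast_ne_zero.2 hm
  simp only [rescale, anchor, Pi.smul_apply, Pi.sub_apply, smul_eq_mul, Fin.val_zero, if_true]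
  field_simp

lemma rescale_succ {m n : ℕ} (hm : m ≠ 0) (z : Fin (n + 2) → ℝ) (j : Fin (n + 1)) :
    rescale m (n + 2) z j.succ = m * z j.succ - (m - 1) := by
  have : (m : ℝ) ≠ 0 := Nat.cast_ne_zero.2 hm
  simp only [rescale, anchor, Pi.smul_apply, Pi.sub_apply, smul_eq_mul, Fin.val_succ,
    Nat.succ_ne_zero, if_false]
  field_simp

lemma real_volume_preimage_rescale {m d : ℕ} (hm : m ≠ 0) (S : Set (Fin d → ℝ)) :
    volume.real (rescale m d ⁻¹' S) = ((m : ℝ) ^ d)⁻¹ * volume.real S := by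
  have hm' : (m : ℝ) ≠ 0 := Nat.cast_ne_zero.2 hm
  have h : rescale m d ⁻¹' S
      = (fun z => z + -anchor m d) ⁻¹' ((fun x : Fin d → ℝ => (m : ℝ) • x) ⁻¹' S) := by
    simp only [Set.preimage_preimage]
    rfl
  have hpos : (0 : ℝ) ≤ ((m : ℝ) ^ d)⁻¹ := by positivity
  rw [measureReal_def, h, measure_preimage_add_right, Measure.addHaar_preimage_smul _ hm',
    Module.finrank_fin_fun, abs_of_nonneg hpos, ENNReal.toReal_mul, ENNReal.toReal_ofReal hpos,
    measureReal_def]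

lemma integral_comp_rescale {m d : ℕ} (f : (Fin d → ℝ) → ℝ) :
    ∫ z, f (rescale m d z) = ((m : ℝ) ^ d)⁻¹ * ∫ u, f u := by
  have hpos : (0 : ℝ) ≤ ((m : ℝ) ^ d)⁻¹ := by positivity
  have h1 := integral_sub_right_eq_self (μ := (volume : Measure (Fin d → ℝ)))
    (fun z => f ((m : ℝ) • z)) (anchor m d)
  simp only [rescale]
  rw [h1, Measure.integral_comp_smul, Module.finrank_fin_fun, abs_of_nonneg hpos, smul_eq_mul]

/-- Split off the first two coordinates. -/
noncomputable def splitTwo (n : ℕ) : (Fin (n + 2) → ℝ) ≃ᵐ (ℝ × ℝ) × (Fin n → ℝ) :=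
  (MeasurableEquiv.piFinSuccAbove (fun _ => ℝ) 0).trans
    (((MeasurableEquiv.refl ℝ).prodCongr (MeasurableEquiv.piFinSuccAbove (fun _ => ℝ) 0)).trans
      MeasurableEquiv.prodAssoc.symm)

lemma splitTwo_apply {n : ℕ} (x : Fin (n + 2) → ℝ) :
    splitTwo n x = ((x 0, x 1), fun j => x j.succ.succ) := rfl

lemma measurePreserving_splitTwo (n : ℕ) : MeasurePreserving (splitTwo n) volume volume := by
  have h1 := volume_preserving_piFinSuccAbove (fun _ : Fin (n + 2) => ℝ) 0
  have h2 := (MeasurePreserving.id (volume : Measure ℝ)).prod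
    (volume_preserving_piFinSuccAbove (fun _ : Fin (n + 1) => ℝ) 0)
  have h3 := (measurePreserving_prodAssoc (volume : Measure ℝ) (volume : Measure ℝ)
    (volume : Measure (Fin n → ℝ))).symm
  exact h3.comp (h2.comp h1)

/-- The prism `W × [0,1]^n`. -/
def prism (n : ℕ) (W : Set (ℝ × ℝ)) : Set (Fin (n + 2) → ℝ) :=
  splitTwo n ⁻¹' (W ×ˢ Set.univ.pi fun _ => Set.Icc (0 : ℝ) 1)

lemma mem_prism {n : ℕ} {W : Set (ℝ × ℝ)} {x : Fin (n + 2) → ℝ} :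
    x ∈ prism n W ↔ (x 0, x 1) ∈ W ∧ ∀ j : Fin n, x j.succ.succ ∈ Set.Icc (0 : ℝ) 1 := by
  simp only [prism, splitTwo_apply, Set.mem_preimage, Set.mem_prod, Set.mem_pi, Set.mem_univ,
    true_imp_iff]

lemma measurableSet_prism {n : ℕ} {W : Set (ℝ × ℝ)} (hW : MeasurableSet W) :
    MeasurableSet (prism n W) :=
  (splitTwo n).measurable (hW.prod (MeasurableSet.univ_pi fun _ => measurableSet_Icc))

lemma cornerCell_eq_preimage {m n : ℕ} (hm : m ≠ 0) (hd : 2 ≤ n + 2) (θ : ℝ) (i : Fin 2) :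
    cornerCell m (n + 2) hd θ i
      = rescale m (n + 2) ⁻¹' prism n (if i = 0 then Omega1 θ else Omega2 θ) := by
  have hm' : (m : ℝ) ≠ 0 := Nat.cast_ne_zero.2 hm
  have hiff : ∀ x : Fin (n + 2) → ℝ,
      (∀ j : Fin (n + 2), 2 ≤ (j : ℕ) → x j ∈ Set.Icc (0 : ℝ) 1) ↔
        ∀ j : Fin n, x j.succ.succ ∈ Set.Icc (0 : ℝ) 1 := fun x => by
    simp [Fin.forall_fin_succ (n := n + 1), Fin.forall_fin_succ (n := n)]
  ext z
  rw [Set.mem_preimage, mem_prism, ← hiff]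
  constructor
  · rintro ⟨x, hx, rfl⟩
    have : rescale m (n + 2) (fun j => anchor m (n + 2) j + x j / m) = x := by
      ext j
      simp only [rescale, Pi.smul_apply, Pi.sub_apply, smul_eq_mul]
      field_simp
      ring
    rw [this]
    exact hx
  · intro h
    refine ⟨rescale m (n + 2) z, h, ?_⟩
    ext j
    simp only [rescale, Pi.smul_apply, Pi.sub_apply, smul_eq_mul]
    field_simp
    ring

/-- The length of `[0,1] ∩ (-∞, t)`. -/
noncomputable def clip (t : ℝ) : ℝ := volume.real (Set.Icc (0 : ℝ) 1 ∩ Set.Iio t)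

lemma clip_of_nonpos {t : ℝ} (ht : t ≤ 0) : clip t = 0 := by
  have : Set.Icc (0 : ℝ) 1 ∩ Set.Iio t = ∅ := by
    ext x
    simp only [Set.mem_inter_iff, Set.mem_Icc, Set.mem_Iio, Set.mem_empty_iff_false, iff_false]
    intro h
    linarith [h.1.1, h.2]
  simp [clip, this]

lemma clip_of_mem {t : ℝ} (ht : t ∈ Set.Ioc (0 : ℝ) 1) : clip t = t := by
  have : Set.Icc (0 : ℝ) 1 ∩ Set.Iio t = Set.Ico 0 t := by
    ext x
    simp only [Set.mem_inter_iff, Set.mem_Icc, Set.mem_Iio, Set.mem_Ico]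
    constructor
    · exact fun h => ⟨h.1.1, h.2⟩
    · exact fun h => ⟨⟨h.1, h.2.le.trans ht.2⟩, h.2⟩
  simp [clip, this, ht.1.le]

lemma cornerArea_of_nonpos {W : Set (ℝ × ℝ)} (hW : W ⊆ I2) {p : ℝ × ℝ} (hp : p.1 ≤ 0 ∨ p.2 ≤ 0) :
    cornerArea W p = 0 := by
  have : W ∩ Set.Iio p.1 ×ˢ Set.Iio p.2 = ∅ := by
    ext x
    simp only [Set.mem_inter_iff, Set.mem_prod, Set.mem_Iio, Set.mem_empty_iff_false, iff_false]
    rintro ⟨hx, h1, h2⟩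
    have := hW hx
    rcases hp with hp | hp
    · linarith [this.1.1]
    · linarith [this.2.1]
  simp [cornerArea, this]

lemma integral_clip_sq : ∫ t, (Set.Iic (1 : ℝ)).indicator (fun t => clip t ^ 2) t = 1 / 3 := by
  rw [integral_indicator measurableSet_Iic,
    setIntegral_eq_of_subset_of_forall_sdiff_eq_zero measurableSet_Iic
      (Set.Ioc_subset_Iic_self (a := (0 : ℝ))),
    setIntegral_congr_fun measurableSet_Ioc (g := fun t => t ^ 2)
      (fun t ht => by simp only [clip_of_mem ht]),
    ← intervalIntegral.integral_of_le zero_le_one, integral_pow]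
  · norm_num
  · intro t ht
    have : t ≤ 0 := by
      by_contra! h
      exact ht.2 ⟨h, ht.1⟩
    simp [clip_of_nonpos this]

lemma real_volume_prism {n : ℕ} {W : Set (ℝ × ℝ)} :
    volume.real (prism n W) = volume.real W := by
  rw [prism, measureReal_def, (measurePreserving_splitTwo n).measure_preimage_equiv,
    Measure.volume_eq_prod, Measure.prod_prod, volume_pi_pi]
  simp [measureReal_def]

lemma real_volume_prism_inter {n : ℕ} {W : Set (ℝ × ℝ)} (u : Fin (n + 2) → ℝ) :
    volume.real (prism n W ∩ {x | ∀ j, x j < u j})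
      = cornerArea W (u 0, u 1) * ∏ j : Fin n, clip (u j.succ.succ) := by
  have hset : prism n W ∩ {x | ∀ j, x j < u j}
      = splitTwo n ⁻¹' ((W ∩ Set.Iio (u 0) ×ˢ Set.Iio (u 1)) ×ˢ
        Set.univ.pi fun j : Fin n => Set.Icc (0 : ℝ) 1 ∩ Set.Iio (u j.succ.succ)) := by
    ext x
    simp only [Set.mem_inter_iff, mem_prism, Set.mem_ofPred_eq, Fin.forall_fin_succ (n := n + 1),
      Fin.forall_fin_succ (n := n), Set.mem_preimage, splitTwo_apply, Set.mem_prod, Set.mem_pi,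
      Set.mem_univ, true_imp_iff, Set.mem_Iio, forall_and, Fin.succ_zero_eq_one]
    tauto
  rw [hset, measureReal_def, (measurePreserving_splitTwo n).measure_preimage_equiv,
    Measure.volume_eq_prod, Measure.prod_prod, volume_pi_pi, ENNReal.toReal_mul,
    ENNReal.toReal_prod]
  rfl

lemma real_volume_preimage_prism_inter_lowerBox {m n : ℕ} (hm : 2 ≤ m) {W : Set (ℝ × ℝ)}
    (hW : W ⊆ I2) (z : Fin (n + 2) → ℝ) :
    volume.real (rescale m (n + 2) ⁻¹' prism n W ∩ lowerBox z)
      = ((m : ℝ) ^ (n + 2))⁻¹ * (cornerArea W (rescale m (n + 2) z 0, rescale m (n + 2) z 1)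
        * ∏ j : Fin n, clip (rescale m (n + 2) z j.succ.succ)) := by
  have hm0 : m ≠ 0 := by omega
  have hm2 : (2 : ℝ) ≤ m := by exact_mod_cast hm
  have hpos : (0 : ℝ) < m := by linarith
  rw [← real_volume_prism_inter, ← real_volume_preimage_rescale hm0, Set.preimage_inter]
  congr 1
  ext y
  simp only [Set.mem_inter_iff, Set.mem_preimage, Set.mem_ofPred_eq]
  refine and_congr_right fun hy => ?_
  rw [mem_prism] at hy
  have hlt : ∀ j, rescale m (n + 2) y j < rescale m (n + 2) z j ↔ y j < z j := fun j => by
    simp only [rescale, Pi.smul_apply, Pi.sub_apply, smul_eq_mul, mul_lt_mul_iff_right₀ hpos,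
      sub_lt_sub_iff_right]
  simp only [hlt, lowerBox, Set.mem_ofPred_eq]
  refine ⟨fun h j => (h j).2, fun h j => ⟨?_, h j⟩⟩
  have h1 := (hW hy.1).1.1
  have h2 := (hW hy.1).2.1
  have h3 := fun j => (hy.2 j).1
  simp only [← Fin.succ_zero_eq_one, rescale_zero hm0, rescale_succ hm0] at h1 h2 h3
  refine Fin.cases ?_ (fun j => Fin.cases ?_ (fun j => ?_) j) j
  · exact nonneg_of_mul_nonneg_right (by linarith) hpos
  · exact nonneg_of_mul_nonneg_right (by linarith) hpos
  · exact nonneg_of_mul_nonneg_right (by linarith [h3 j]) hpos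

lemma integral_sq_preimage_prism {m n : ℕ} (hm : 2 ≤ m) {W : Set (ℝ × ℝ)} (hW : W ⊆ I2) :
    ∫ z in unitCube (n + 2), volume.real (rescale m (n + 2) ⁻¹' prism n W ∩ lowerBox z) ^ 2
      = 1 / ((m : ℝ) ^ (n + 2)) ^ 3 * (1 / 3 ^ n)
        * ∫ p in Set.Ioc (0 : ℝ) 2 ×ˢ Set.Ioc (0 : ℝ) 1, cornerArea W p ^ 2 := by
  have hm0 : m ≠ 0 := by omega
  have hm2 : (2 : ℝ) ≤ m := by exact_mod_cast hm
  have hpos : (0 : ℝ) < m := by linarith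
  set G : ℝ × ℝ → ℝ :=
    (Set.Iic (2 : ℝ) ×ˢ Set.Iic (1 : ℝ)).indicator (fun p => cornerArea W p ^ 2) with hG
  set c : ℝ → ℝ := (Set.Iic (1 : ℝ)).indicator (fun t => clip t ^ 2) with hc
  set Φ : (Fin (n + 2) → ℝ) → ℝ := fun u => G (u 0, u 1) * ∏ j : Fin n, c (u j.succ.succ) with hΦ
  have hG_zero : ∀ p : ℝ × ℝ, ¬(p.1 ∈ Set.Ioc (0 : ℝ) 2 ∧ p.2 ∈ Set.Ioc (0 : ℝ) 1) → G p = 0 := by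
    intro p hp
    by_cases hp' : p ∈ Set.Iic (2 : ℝ) ×ˢ Set.Iic (1 : ℝ)
    · have : p.1 ≤ 0 ∨ p.2 ≤ 0 := by
        by_contra! h
        exact hp ⟨⟨h.1, hp'.1⟩, h.2, hp'.2⟩
      rw [hG, Set.indicator_of_mem hp', cornerArea_of_nonpos hW this]
      norm_num
    · exact Set.indicator_of_notMem hp' _
  have hc_zero : ∀ t : ℝ, t ∉ Set.Ioc (0 : ℝ) 1 → c t = 0 := by
    intro t ht
    by_cases ht' : t ∈ Set.Iic (1 : ℝ)
    · have : t ≤ 0 := by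
        by_contra! h
        exact ht ⟨h, ht'⟩
      rw [hc, Set.indicator_of_mem ht', clip_of_nonpos this]
      norm_num
    · exact Set.indicator_of_notMem ht' _
  have hpoint : ∀ z : Fin (n + 2) → ℝ, (unitCube (n + 2)).indicator
      (fun z => volume.real (rescale m (n + 2) ⁻¹' prism n W ∩ lowerBox z) ^ 2) z
      = (((m : ℝ) ^ (n + 2))⁻¹) ^ 2 * Φ (rescale m (n + 2) z) := by
    intro z
    have hcube : z ∈ unitCube (n + 2) ↔ z 0 ∈ Set.Icc (0 : ℝ) 1 ∧ z 1 ∈ Set.Icc (0 : ℝ) 1 ∧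
        ∀ j : Fin n, z j.succ.succ ∈ Set.Icc (0 : ℝ) 1 := by
      simp only [unitCube, Set.mem_pi, Set.mem_univ, true_imp_iff, Fin.forall_fin_succ (n := n + 1),
        Fin.forall_fin_succ (n := n), Fin.succ_zero_eq_one]
    have hz1 : rescale m (n + 2) z 1 = m * z 1 - (m - 1) := rescale_succ hm0 z 0
    by_cases hz : z ∈ unitCube (n + 2)
    · rw [Set.indicator_of_mem hz, real_volume_preimage_prism_inter_lowerBox hm hW]
      rw [hcube] at hz
      have hle : ∀ t : ℝ, t ∈ Set.Icc (0 : ℝ) 1 → (m : ℝ) * t ≤ m := fun t ht =>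
        mul_le_of_le_one_right hpos.le ht.2
      have hmem : (rescale m (n + 2) z 0, rescale m (n + 2) z 1) ∈
          Set.Iic (2 : ℝ) ×ˢ Set.Iic (1 : ℝ) := by
        simp only [Set.mem_prod, Set.mem_Iic, rescale_zero hm0, hz1]
        constructor
        · linarith [hle _ hz.1]
        · linarith [hle _ hz.2.1]
      have hmem' : ∀ j : Fin n, rescale m (n + 2) z j.succ.succ ∈ Set.Iic (1 : ℝ) := fun j => by
        simp only [Set.mem_Iic, rescale_succ hm0]
        linarith [hle _ (hz.2.2 j)]
      simp only [hΦ, hG, hc, Set.indicator_of_mem hmem, Set.indicator_of_mem (hmem' _),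
        mul_pow, Finset.prod_pow]
    · rw [Set.indicator_of_notMem hz, eq_comm]
      refine mul_eq_zero_of_right _ ?_
      have hcoord : ∀ t : ℝ, 0 < m * t - (m - 1) → m * t - (m - 1) ≤ 1 → t ∈ Set.Icc (0 : ℝ) 1 :=
        fun t h1 h2 => ⟨(pos_of_mul_pos_right (by linarith) hpos.le).le,
          le_of_mul_le_mul_left (by linarith) hpos⟩
      by_contra hne
      refine hz (hcube.2 ?_)
      have h1 := left_ne_zero_of_mul hne
      have h2 := fun j => Finset.prod_ne_zero_iff.1 (right_ne_zero_of_mul hne) j (Finset.mem_univ j)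
      have h1' := not_not.1 (mt (hG_zero _) h1)
      have h2' := fun j => not_not.1 (mt (hc_zero _) (h2 j))
      simp only [rescale_zero hm0, hz1, rescale_succ hm0] at h1' h2'
      refine ⟨⟨?_, ?_⟩, hcoord _ h1'.2.1 h1'.2.2, fun j => hcoord _ (h2' j).1 (h2' j).2⟩
      · exact (pos_of_mul_pos_right (a := (m : ℝ)) (by linarith [h1'.1.1]) hpos.le).le
      · exact le_of_mul_le_mul_left (a := (m : ℝ)) (by linarith [h1'.1.2]) hpos
  have hsplit : ∫ u, Φ u = (∫ p, G p) * (1 / 3) ^ n := by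
    have h := (measurePreserving_splitTwo n).integral_comp'
      (fun q : (ℝ × ℝ) × (Fin n → ℝ) => G q.1 * ∏ j : Fin n, c (q.2 j))
    simp only [splitTwo_apply] at h
    rw [hΦ, h, Measure.volume_eq_prod,
      integral_prod_mul (f := G) (g := fun y : Fin n → ℝ => ∏ j, c (y j)),
      integral_fintype_prod_volume_eq_pow c, integral_clip_sq, Fintype.card_fin]
  have hGint : ∫ p, G p = ∫ p in Set.Ioc (0 : ℝ) 2 ×ˢ Set.Ioc (0 : ℝ) 1, cornerArea W p ^ 2 := by
    rw [hG, integral_indicator (measurableSet_Iic.prod measurableSet_Iic)]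
    refine setIntegral_eq_of_subset_of_forall_sdiff_eq_zero
      (measurableSet_Iic.prod measurableSet_Iic)
      (Set.prod_mono Set.Ioc_subset_Iic_self Set.Ioc_subset_Iic_self) fun p hp => ?_
    have h := hG_zero p hp.2
    rwa [hG, Set.indicator_of_mem hp.1] at h
  rw [← integral_indicator (measurableSet_unitCube _)]
  simp only [hpoint, integral_const_mul]
  rw [integral_comp_rescale, hsplit, hGint, one_div_pow]
  field_simp

/-- The index of the first corner cell. -/
def leftIndex {m : ℕ} (n : ℕ) (hm : 2 ≤ m) : Fin (n + 2) → Fin m :=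
  fun j => ⟨if (j : ℕ) = 0 then m - 2 else m - 1, by split_ifs <;> omega⟩

/-- The index of the second corner cell. -/
def rightIndex {m : ℕ} (n : ℕ) (hm : 2 ≤ m) : Fin (n + 2) → Fin m :=
  fun _ => ⟨m - 1, by omega⟩

lemma leftIndex_ne_rightIndex {m n : ℕ} (hm : 2 ≤ m) : leftIndex n hm ≠ rightIndex n hm := by
  intro h
  have := congrArg Fin.val (congrFun h 0)
  simp only [leftIndex, rightIndex, Fin.val_zero, if_true] at this
  omega

lemma OmegaStarSim_eq_ite {m n : ℕ} (hm : 2 ≤ m) (hd : 2 ≤ n + 2) (θ : ℝ)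
    (k : Fin (n + 2) → Fin m) :
    OmegaStarSim m (n + 2) hd θ k
      = if k = leftIndex n hm then rescale m (n + 2) ⁻¹' prism n (Omega1 θ)
        else if k = rightIndex n hm then rescale m (n + 2) ⁻¹' prism n (Omega2 θ)
        else gridCell m k := by
  have hm0 : m ≠ 0 := by omega
  have h1 : (∀ j, (k j : ℕ) = if (j : ℕ) = 0 then m - 2 else m - 1) ↔ k = leftIndex n hm := by
    simp only [funext_iff, Fin.ext_iff, leftIndex]
  have h2 : (∀ j, (k j : ℕ) = m - 1) ↔ k = rightIndex n hm := by
    simp only [funext_iff, Fin.ext_iff, rightIndex]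
  simp only [OmegaStarSim, cornerCell_eq_preimage hm0, h1, h2, if_true, one_ne_zero, if_false]

lemma measurableSet_OmegaStarSim {m n : ℕ} (hm : 2 ≤ m) (hd : 2 ≤ n + 2) (θ : ℝ)
    (k : Fin (n + 2) → Fin m) : MeasurableSet (OmegaStarSim m (n + 2) hd θ k) := by
  have hmeas := (continuous_rescale m (n + 2)).measurable
  rw [OmegaStarSim_eq_ite hm]
  split_ifs
  · exact hmeas (measurableSet_prism (measurableSet_Omega1 θ))
  · exact hmeas (measurableSet_prism (measurableSet_Omega2 θ))
  · exact MeasurableSet.univ_pi fun _ => measurableSet_Ico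

lemma real_volume_gridCell {m d : ℕ} (k : Fin d → Fin m) :
    volume.real (gridCell m k) = ((m : ℝ) ^ d)⁻¹ := by
  have hside : ∀ t : ℝ, (t + 1) / m - t / m = (m : ℝ)⁻¹ := fun t => by ring
  have hpos : (0 : ℝ) ≤ (m : ℝ)⁻¹ := by positivity
  rw [gridCell, measureReal_def, volume_pi_pi, ENNReal.toReal_prod]
  simp [Real.volume_Ico, hside, ENNReal.toReal_ofReal hpos]

lemma real_volume_OmegaStarSim {m n : ℕ} (hm : 2 ≤ m) (hd : 2 ≤ n + 2) {θ : ℝ}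
    (hθ : θ ∈ Set.Icc 0 (π / 2)) (k : Fin (n + 2) → Fin m) :
    volume.real (OmegaStarSim m (n + 2) hd θ k) = ((m : ℝ) ^ (n + 2))⁻¹ := by
  have hm0 : m ≠ 0 := by omega
  rw [OmegaStarSim_eq_ite hm]
  split_ifs
  · rw [real_volume_preimage_rescale hm0, real_volume_prism, real_volume_Omega1 hθ, mul_one]
  · rw [real_volume_preimage_rescale hm0, real_volume_prism, real_volume_Omega2 hθ, mul_one]
  · exact real_volume_gridCell k

lemma mem_gridCell_iff {m d : ℕ} (hm : 0 < m) {k : Fin d → Fin m} {x : Fin d → ℝ} :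
    x ∈ gridCell m k ↔ ∀ j, (k j : ℝ) ≤ m * x j ∧ m * x j < k j + 1 := by
  have hm' : (0 : ℝ) < m := by exact_mod_cast hm
  simp only [gridCell, Set.mem_pi, Set.mem_univ, true_imp_iff, Set.mem_Ico, div_le_iff₀' hm',
    lt_div_iff₀' hm']

lemma exists_mem_gridCell {m d : ℕ} (hm : 0 < m) {x : Fin d → ℝ}
    (hx : ∀ j, x j ∈ Set.Ico (0 : ℝ) 1) : ∃ k : Fin d → Fin m, x ∈ gridCell m k := by
  have hm' : (0 : ℝ) < m := by exact_mod_cast hm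
  have hnonneg : ∀ j, 0 ≤ (m : ℝ) * x j := fun j => mul_nonneg hm'.le (hx j).1
  refine ⟨fun j => ⟨⌊(m : ℝ) * x j⌋₊, ?_⟩, (mem_gridCell_iff hm).2 fun j => ?_⟩
  · rw [Nat.floor_lt (hnonneg j)]
    exact mul_lt_of_lt_one_right hm' (hx j).2
  · exact ⟨Nat.floor_le (hnonneg j), Nat.lt_floor_add_one _⟩

lemma rescale_mem_prism_I2 {m n : ℕ} (hm : 2 ≤ m) {k : Fin (n + 2) → Fin m} {x : Fin (n + 2) → ℝ}
    (hk : k = leftIndex n hm ∨ k = rightIndex n hm) (hx : x ∈ gridCell m k) :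
    rescale m (n + 2) x ∈ prism n I2 := by
  have hm0 : m ≠ 0 := by omega
  have hcast1 : ((m - 1 : ℕ) : ℝ) = m - 1 := by push_cast [show 1 ≤ m by omega]; ring
  have hcast2 : ((m - 2 : ℕ) : ℝ) = m - 2 := by push_cast [hm]; ring
  rw [mem_gridCell_iff (by omega)] at hx
  have hzero : 0 ≤ rescale m (n + 2) x 0 ∧ rescale m (n + 2) x 0 ≤ 2 := by
    have h := hx 0
    rw [rescale_zero hm0]
    rcases hk with rfl | rfl
    · simp only [leftIndex, Fin.val_zero, if_true, hcast2] at h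
      constructor <;> linarith
    · simp only [rightIndex, hcast1] at h
      constructor <;> linarith
  have hsucc : ∀ j : Fin (n + 1), rescale m (n + 2) x j.succ ∈ Set.Icc (0 : ℝ) 1 := fun j => by
    have h := hx j.succ
    have hkj : (k j.succ : ℝ) = m - 1 := by
      rcases hk with rfl | rfl
      · simp [leftIndex, hcast1]
      · simp [rightIndex, hcast1]
    rw [rescale_succ hm0]
    rw [hkj] at h
    constructor <;> linarith
  exact mem_prism.2 ⟨⟨hzero, hsucc 0⟩, fun j => hsucc j.succ⟩

lemma pi_Ico_subset_iUnion_OmegaStarSim {m n : ℕ} (hm : 2 ≤ m) (hd : 2 ≤ n + 2) (θ : ℝ) :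
    (Set.univ.pi fun _ => Set.Ico (0 : ℝ) 1) ⊆ ⋃ k, OmegaStarSim m (n + 2) hd θ k := by
  intro x hx
  obtain ⟨k, hk⟩ := exists_mem_gridCell (m := m) (by omega) (fun j => hx j (Set.mem_univ j))
  rw [Set.mem_iUnion]
  by_cases hcorner : k = leftIndex n hm ∨ k = rightIndex n hm
  · have hprism := mem_prism.1 (rescale_mem_prism_I2 hm hcorner hk)
    rcases I2_subset_union θ hprism.1 with h | h
    · refine ⟨leftIndex n hm, ?_⟩
      rw [OmegaStarSim_eq_ite hm, if_pos rfl]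
      exact mem_prism.2 ⟨h, hprism.2⟩
    · refine ⟨rightIndex n hm, ?_⟩
      rw [OmegaStarSim_eq_ite hm, if_neg (leftIndex_ne_rightIndex hm).symm, if_pos rfl]
      exact mem_prism.2 ⟨h, hprism.2⟩
  · rw [not_or] at hcorner
    refine ⟨k, ?_⟩
    rwa [OmegaStarSim_eq_ite hm, if_neg hcorner.1, if_neg hcorner.2]

lemma Pfun_pi_div_two : Pfun (π / 2) = 0 := by
  have h := Real.arctan_lt_pi_div_two (1 / 2)
  rw [Pfun, if_neg h.not_gt, if_neg h.ne', Real.cot_eq_cos_div_sin, Real.cos_pi_div_two]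
  norm_num

lemma expL2sq_OmegaStarSim {m n : ℕ} (hm : 2 ≤ m) (hd : 2 ≤ n + 2) {θ : ℝ}
    (hθ : θ ∈ Set.Icc 0 (π / 2)) :
    expL2sq (OmegaStarSim m (n + 2) hd θ)
      = (∫ z in unitCube (n + 2), ((m : ℝ) ^ (n + 2))⁻¹ * volume.real (lowerBox z))
        - (∑ k ∈ Finset.univ \ {leftIndex n hm, rightIndex n hm},
            ∫ z in unitCube (n + 2), volume.real (gridCell m k ∩ lowerBox z) ^ 2)
        - 1 / ((m : ℝ) ^ (n + 2)) ^ 3 * (1 / 3 ^ n) * (5 / 9 - Pfun θ) := by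
  have hcard : (Fintype.card (Fin (n + 2) → Fin m) : ℝ) = (m : ℝ) ^ (n + 2) := by simp
  have : Nonempty (Fin (n + 2) → Fin m) := ⟨leftIndex n hm⟩
  rw [expL2sq_eq (measurableSet_OmegaStarSim hm hd θ)
    (fun k => by rw [hcard, real_volume_OmegaStarSim hm hd hθ k])
    (pi_Ico_subset_iUnion_OmegaStarSim hm hd θ), hcard,
    ← Finset.sum_sdiff (Finset.subset_univ {leftIndex n hm, rightIndex n hm}),
    Finset.sum_pair (leftIndex_ne_rightIndex hm), OmegaStarSim_eq_ite hm hd θ (leftIndex n hm),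
    OmegaStarSim_eq_ite hm hd θ (rightIndex n hm), if_pos rfl,
    if_neg (leftIndex_ne_rightIndex hm).symm, if_pos rfl,
    integral_sq_preimage_prism hm (Omega1_subset_I2 θ),
    integral_sq_preimage_prism hm (Omega2_subset_I2 θ), ← mul_add, integral_cornerArea_sq_add hθ,
    sub_sub]
  congr 2
  refine Finset.sum_congr rfl fun k hk => ?_
  simp only [Finset.mem_sdiff, Finset.mem_insert, Finset.mem_singleton, not_or] at hk
  rw [OmegaStarSim_eq_ite hm, if_neg hk.2.1, if_neg hk.2.2]

/-- For integers `m ≥ d ≥ 2`, `N = m^d`, and `θ ∈ [0, π/2]`, the difference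
of the expected squared `L₂`-discrepancies of the stratified samples from `Ω*∼(θ)` and from
the grid partition `Ω*_| = Ω*∼(π/2)` equals exactly `(1/N³)·(1/3^(d-2))·P(θ)`. -/
theorem expL2sq_OmegaStarSim_sub_jittered (m d : ℕ) (hd : 2 ≤ d) (hm : d ≤ m)
    (θ : ℝ) (hθ : θ ∈ Set.Icc 0 (π / 2)) :
    expL2sq (OmegaStarSim m d hd θ) - expL2sq (OmegaStarSim m d hd (π / 2))
      = 1 / ((m : ℝ) ^ d) ^ 3 * (1 / (3 : ℝ) ^ (d - 2)) * Pfun θ := by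
  obtain ⟨n, rfl⟩ : ∃ n, d = n + 2 := ⟨d - 2, by omega⟩
  have hm2 : 2 ≤ m := by omega
  rw [expL2sq_OmegaStarSim hm2 hd hθ,
    expL2sq_OmegaStarSim hm2 hd (Set.right_mem_Icc.2 (by positivity)), Pfun_pi_div_two,
    Nat.add_sub_cancel]
  ring
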